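/- Let f : ℝⁿ×ℝᵐ → ℝ and g : ℝⁿ×ℝᵐ → ℝᵖ be continuously differentiable, and assume inf-compactness at x̄. Suppose S(x̄) = {ȳ₁, ȳ₂} with ȳ₁ ≠ ȳ₂, and suppose there are continuous maps y₁, y₂ defined on a neighborhood N of x̄ with y_k(x̄) = ȳ_k and y_k(x) ∈ Y(x) for all x ∈ N (k = 1,2), together with neighborhoods U_k of (x̄,ȳ_k) such that every (x,y) ∈ U_k with y a generalized critical point of L(x) satisfies y = y_k(x). Then there is a neighborhood N' ⊆ N of x̄ such that for every x ∈ N': S(x) is nonempty, S(x) ⊆ {y₁(x), y₂(x)}, and V(x) = min{f(x, y₁(x)), f(x, y₂(x))}. -/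

import Mathlib

open scoped RealInnerProductSpace
open Topology

noncomputable section

/-- The lower-level feasible set `Y(x) = {y : g(x,y) ≤ 0}`. -/
def Yset {n m p : ℕ}
    (g : EuclideanSpace ℝ (Fin n) × EuclideanSpace ℝ (Fin m) → Fin p → ℝ)
    (x : EuclideanSpace ℝ (Fin n)) : Set (EuclideanSpace ℝ (Fin m)) :=
  {y | ∀ j, g (x, y) j ≤ 0}

/-- The lower-level solution set `S(x)`. -/
def Sset {n m p : ℕ}
    (f : EuclideanSpace ℝ (Fin n) × EuclideanSpace ℝ (Fin m) → ℝ)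
    (g : EuclideanSpace ℝ (Fin n) × EuclideanSpace ℝ (Fin m) → Fin p → ℝ)
    (x : EuclideanSpace ℝ (Fin n)) : Set (EuclideanSpace ℝ (Fin m)) :=
  {y | y ∈ Yset g x ∧ ∀ y' ∈ Yset g x, f (x, y) ≤ f (x, y')}

/-- The value function `V(x) = inf {f(x,y) : y ∈ Y(x)}`. -/
def Vval {n m p : ℕ}
    (f : EuclideanSpace ℝ (Fin n) × EuclideanSpace ℝ (Fin m) → ℝ)
    (g : EuclideanSpace ℝ (Fin n) × EuclideanSpace ℝ (Fin m) → Fin p → ℝ)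
    (x : EuclideanSpace ℝ (Fin n)) : ℝ :=
  sInf ((fun y => f (x, y)) '' Yset g x)

/-- The partial gradient `∇_y f (x,y)`. -/
def gradY {n m : ℕ}
    (f : EuclideanSpace ℝ (Fin n) × EuclideanSpace ℝ (Fin m) → ℝ)
    (x : EuclideanSpace ℝ (Fin n)) (y : EuclideanSpace ℝ (Fin m)) :
    EuclideanSpace ℝ (Fin m) :=
  gradient (fun y' => f (x, y')) y

/-- The partial gradient `∇_y g_j (x,y)`. -/
def gradYg {n m p : ℕ}
    (g : EuclideanSpace ℝ (Fin n) × EuclideanSpace ℝ (Fin m) → Fin p → ℝ)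
    (x : EuclideanSpace ℝ (Fin n)) (y : EuclideanSpace ℝ (Fin m)) (j : Fin p) :
    EuclideanSpace ℝ (Fin m) :=
  gradient (fun y' => g (x, y') j) y

/-- `y` is a generalized critical (g.c.) point of `L(x)`. -/
def gcPoint {n m p : ℕ}
    (f : EuclideanSpace ℝ (Fin n) × EuclideanSpace ℝ (Fin m) → ℝ)
    (g : EuclideanSpace ℝ (Fin n) × EuclideanSpace ℝ (Fin m) → Fin p → ℝ)
    (x : EuclideanSpace ℝ (Fin n)) (y : EuclideanSpace ℝ (Fin m)) : Prop :=
  (∀ j, g (x, y) j ≤ 0) ∧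
    ∃ (u₀ : ℝ) (u : Fin p → ℝ), (u₀, u) ≠ 0 ∧
      (∀ j, g (x, y) j ≠ 0 → u j = 0) ∧
      u₀ • gradY f x y + ∑ j, u j • gradYg g x y j = 0

theorem fritzJohn_aux {n m p : ℕ}
    (f : EuclideanSpace ℝ (Fin n) × EuclideanSpace ℝ (Fin m) → ℝ)
    (g : EuclideanSpace ℝ (Fin n) × EuclideanSpace ℝ (Fin m) → Fin p → ℝ)
    (hf : ContDiff ℝ 1 f) (hg : ContDiff ℝ 1 g)
    (x : EuclideanSpace ℝ (Fin n)) (y : EuclideanSpace ℝ (Fin m))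
    (hy : y ∈ Sset f g x) : gcPoint f g x y := by
  classical
  obtain ⟨hyY, hmin⟩ := hy
  refine ⟨hyY, ?_⟩
  have hfy : ContDiff ℝ 1 (fun y' => f (x, y')) := hf.comp (contDiff_prodMk_right x)
  have hgy : ∀ j, ContDiff ℝ 1 (fun y' => g (x, y') j) := fun j =>
    (contDiff_pi.1 hg j).comp (contDiff_prodMk_right x)
  have hfs := (hfy.contDiffAt (x := y)).hasStrictFDerivAt one_ne_zero
  have hgs := fun j => ((hgy j).contDiffAt (x := y)).hasStrictFDerivAt one_ne_zero
  have hext : IsLocalExtrOn (fun y' => f (x, y'))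
      {z | ∀ i : {j // g (x, y) j = 0}, g (x, z) i = g (x, y) i} y := by
    left
    have h1 : ∀ᶠ z in 𝓝 y, ∀ j, g (x, y) j ≠ 0 → g (x, z) j < 0 := by
      rw [Filter.eventually_all]
      intro j
      by_cases hj : g (x, y) j = 0
      · exact Filter.Eventually.of_forall fun z h => absurd hj h
      · have : g (x, y) j < 0 := lt_of_le_of_ne (hyY j) hj
        filter_upwards [(hgy j).continuous.continuousAt.eventually_lt_const this] with z hz _
        exact hz
    have h2 := h1.filter_mono (nhdsWithin_le_nhds
      (s := {z | ∀ i : {j // g (x, y) j = 0}, g (x, z) i = g (x, y) i}))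
    filter_upwards [h2, self_mem_nhdsWithin] with z hz hzs
    apply hmin
    intro j
    by_cases hj : g (x, y) j = 0
    · exact ((hzs ⟨j, hj⟩).trans hj).le
    · exact (hz j hj).le
  obtain ⟨L, L0, hL, hsum⟩ := IsLocalExtrOn.exists_multipliers_of_hasStrictFDerivAt
    (f := fun (i : {j // g (x, y) j = 0}) z => g (x, z) i) hext (fun i => hgs i) hfs
  refine ⟨L0, fun j => if h : g (x, y) j = 0 then L ⟨j, h⟩ else 0, ?_, ?_, ?_⟩
  · intro h
    apply hL
    rw [Prod.mk_eq_zero] at h ⊢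
    refine ⟨?_, h.1⟩
    funext i
    have := congrFun h.2 i
    simpa [i.2] using this
  · intro j hj
    simp [hj]
  · have e1 : ∑ j, (if h : g (x, y) j = 0 then L ⟨j, h⟩ else 0) • gradYg g x y j
        = ∑ i : {j // g (x, y) j = 0}, L i • gradYg g x y i := by
      rw [← Finset.sum_subset (Finset.subset_univ (Finset.univ.filter fun j => g (x, y) j = 0))
        (by intro j _ hj; simp at hj; simp [hj])]
      rw [Finset.sum_subtype (p := fun j => g (x, y) j = 0) _ (by simp)]
      apply Finset.sum_congr rfl
      intro i _
      simp [i.2]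
    rw [e1]
    apply (InnerProductSpace.toDual ℝ (EuclideanSpace ℝ (Fin m))).injective
    rw [map_zero, ← hsum, map_add, map_sum, add_comm]
    simp [gradY, gradYg, gradient]

theorem statement12 {n m p : ℕ}
    (f : EuclideanSpace ℝ (Fin n) × EuclideanSpace ℝ (Fin m) → ℝ)
    (g : EuclideanSpace ℝ (Fin n) × EuclideanSpace ℝ (Fin m) → Fin p → ℝ)
    (hf : ContDiff ℝ 1 f) (hg : ContDiff ℝ 1 g)
    (xbar : EuclideanSpace ℝ (Fin n))
    -- inf-compactness at x̄
    (hIC : ∀ c : ℝ, IsCompact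
      {z : EuclideanSpace ℝ (Fin n) × EuclideanSpace ℝ (Fin m) |
        ‖z.1 - xbar‖ ≤ 1 ∧ f z ≤ c ∧ ∀ j, g z j ≤ 0})
    (ybar1 ybar2 : EuclideanSpace ℝ (Fin m)) (hne : ybar1 ≠ ybar2)
    (hS : Sset f g xbar = {ybar1, ybar2})
    (N : Set (EuclideanSpace ℝ (Fin n))) (hN : N ∈ 𝓝 xbar)
    (y1 y2 : EuclideanSpace ℝ (Fin n) → EuclideanSpace ℝ (Fin m))
    (hy1c : ContinuousOn y1 N) (hy2c : ContinuousOn y2 N)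
    (hy1bar : y1 xbar = ybar1) (hy2bar : y2 xbar = ybar2)
    (hy1Y : ∀ x ∈ N, y1 x ∈ Yset g x) (hy2Y : ∀ x ∈ N, y2 x ∈ Yset g x)
    (U1 : Set (EuclideanSpace ℝ (Fin n) × EuclideanSpace ℝ (Fin m)))
    (hU1 : U1 ∈ 𝓝 (xbar, ybar1))
    (U2 : Set (EuclideanSpace ℝ (Fin n) × EuclideanSpace ℝ (Fin m)))
    (hU2 : U2 ∈ 𝓝 (xbar, ybar2))
    (hloc1 : ∀ z ∈ U1, gcPoint f g z.1 z.2 → z.2 = y1 z.1)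
    (hloc2 : ∀ z ∈ U2, gcPoint f g z.1 z.2 → z.2 = y2 z.1) :
    ∃ N' ∈ 𝓝 xbar, N' ⊆ N ∧ ∀ x ∈ N',
      (Sset f g x).Nonempty ∧
      Sset f g x ⊆ {y1 x, y2 x} ∧
      Vval f g x = min (f (x, y1 x)) (f (x, y2 x)) := by
  
  have hxy : ∀ᶠ x in 𝓝 xbar, x ∈ N := hN
  have hc1 : ContinuousAt y1 xbar := hy1c.continuousAt hN
  have hcf : ContinuousAt (fun x => f (x, y1 x)) xbar :=
    ContinuousAt.comp (f := fun x => (x, y1 x)) hf.continuous.continuousAt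
      (continuousAt_id.prodMk hc1)
  have hlt : ∀ᶠ x in 𝓝 xbar, f (x, y1 x) < f (xbar, ybar1) + 1 :=
    hcf.eventually_lt_const (by simp [hy1bar])
  have hball : ∀ᶠ x in 𝓝 xbar, ‖x - xbar‖ ≤ 1 := by
    filter_upwards [Metric.closedBall_mem_nhds xbar one_pos] with x hx
    simpa [dist_eq_norm] using hx
  have hb1 : ybar1 ∈ Sset f g xbar := by simp [hS]
  have hK := (hIC (f (xbar, ybar1) + 1)).image continuous_snd
  have key : ∀ᶠ x in 𝓝 xbar, ∀ y ∈ Prod.snd '' {z : EuclideanSpace ℝ (Fin n) × EuclideanSpace ℝ (Fin m) |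
        ‖z.1 - xbar‖ ≤ 1 ∧ f z ≤ f (xbar, ybar1) + 1 ∧ ∀ j, g z j ≤ 0},
        ((∀ j, g (x, y) j ≤ 0) ∧ f (x, y) ≤ f (x, y1 x)) → (x, y) ∈ U1 ∪ U2 := by
    apply hK.eventually_forall_of_forall_eventually
    intro y _
    by_cases hyS : y ∈ Sset f g xbar
    · rw [hS] at hyS
      rcases hyS with h | h
      · filter_upwards [h ▸ hU1] with z hz _ using Or.inl hz
      · filter_upwards [(Set.mem_singleton_iff.1 h) ▸ hU2] with z hz _ using Or.inr hz
    by_cases hyY : y ∈ Yset g xbar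
    · have hgt : f (xbar, y1 xbar) < f (xbar, y) := by
        by_contra hcon
        apply hyS
        refine ⟨hyY, fun y' hy' => (not_lt.1 hcon).trans ?_⟩
        rw [hy1bar]
        exact hb1.2 y' hy'
      have h1 : ContinuousAt (fun z : EuclideanSpace ℝ (Fin n) × EuclideanSpace ℝ (Fin m) =>
          f (z.1, y1 z.1)) (xbar, y) :=
        ContinuousAt.comp (g := fun x => f (x, y1 x)) (f := Prod.fst) hcf continuousAt_fst
      filter_upwards [h1.eventually_lt hf.continuous.continuousAt hgt] with z hz h
      exact absurd h.2 (not_le.2 hz)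
    · have : ∃ j, 0 < g (xbar, y) j := by
        by_contra hcon
        push Not at hcon
        exact hyY hcon
      obtain ⟨j, hj⟩ := this
      have hgj : Continuous (fun z => g z j) := (contDiff_pi.1 hg j).continuous
      filter_upwards [hgj.continuousAt.eventually_const_lt hj] with z hz h
      exact absurd (h.1 j) (not_le.2 hz)
  have hfin := hxy.and (hlt.and (hball.and key))
  refine ⟨_, hfin, fun x hx => hx.1, ?_⟩
  rintro x ⟨hxN, hxlt, hxb, hxk⟩
  have hsub : Sset f g x ⊆ {y1 x, y2 x} := by
    intro y hy
    have hle := hy.2 _ (hy1Y x hxN)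
    have hgc := fritzJohn_aux f g hf hg x y hy
    rcases hxk y ⟨(x, y), ⟨hxb, hle.trans hxlt.le, hy.1⟩, rfl⟩ ⟨hy.1, hle⟩ with h | h
    · exact Or.inl (hloc1 _ h hgc)
    · exact Or.inr (hloc2 _ h hgc)
  have hne' : (Sset f g x).Nonempty := by
    have hC : IsCompact ({z : EuclideanSpace ℝ (Fin n) × EuclideanSpace ℝ (Fin m) |
        ‖z.1 - xbar‖ ≤ 1 ∧ f z ≤ f (x, y1 x) ∧ ∀ j, g z j ≤ 0} ∩ {z | z.1 = x}) :=
      (hIC _).inter_right (isClosed_eq continuous_fst continuous_const)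
    obtain ⟨⟨x', y⟩, ⟨⟨h1, h2, h3⟩, h4⟩, hmin⟩ := hC.exists_isMinOn
      ⟨(x, y1 x), ⟨hxb, le_rfl, hy1Y x hxN⟩, rfl⟩ hf.continuous.continuousOn
    obtain rfl : x' = x := h4
    refine ⟨y, h3, fun y' hy' => ?_⟩
    by_cases h : f (x', y') ≤ f (x', y1 x')
    · exact hmin (a := (x', y')) ⟨⟨hxb, h, hy'⟩, rfl⟩
    · exact h2.trans (not_le.1 h).le
  refine ⟨hne', hsub, ?_⟩
  obtain ⟨y, hy⟩ := hne'
  have hV : Vval f g x = f (x, y) := by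
    apply IsLeast.csInf_eq
    refine ⟨⟨y, hy.1, rfl⟩, ?_⟩
    rintro _ ⟨y', hy', rfl⟩
    exact hy.2 y' hy'
  rw [hV]
  apply le_antisymm (le_min (hy.2 _ (hy1Y x hxN)) (hy.2 _ (hy2Y x hxN)))
  rcases hsub hy with h | h
  · rw [h]; exact min_le_left _ _
  · rw [Set.mem_singleton_iff.1 h]; exact min_le_right _ _
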